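/- Let H be a quaternionic Hilbert space, T ∈ B(H), and let M be a closed ℍ-submodule of H invariant under T (i.e. T(M) ⊆ M). Then σ_S(T|_M) ⊆ η(σ_S(T)), where T|_M ∈ B(M) is the restriction of T to M and η(σ_S(T)) is the full S-spectrum of T, namely the union of σ_S(T) with all bounded connected components of ρ_S(T). -/

import Mathlib

noncomputable section
notation "ℍ" => Quaternion ℝ

section General

variable {W : Type*} [NormedAddCommGroup W] [Module ℍ W] [Module ℝ W]
  [SMulCommClass ℍ ℝ W] [ContinuousConstSMul ℝ W]

/-- The pseudo-resolvent second-order operator `𝒬_s(T) = T² − 2(Re s)·T + ‖s‖²·I`. -/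
def QOp (T : W →L[ℍ] W) (s : ℍ) : W →L[ℍ] W :=
  T ∘L T - (2 * s.re) • T + (‖s‖ ^ 2) • (1 : W →L[ℍ] W)

/-- The S-spectrum of `T`. -/
def sSpectrum (T : W →L[ℍ] W) : Set ℍ := {s | ¬ IsUnit (QOp T s)}

/-- The full S-spectrum `η(σ_S(T))`: the S-spectrum together with all bounded
connected components of the S-resolvent set. -/
def fullSSpectrum (T : W →L[ℍ] W) : Set ℍ :=
  sSpectrum T ∪
    {s | s ∉ sSpectrum T ∧ Bornology.IsBounded (connectedComponentIn (sSpectrum T)ᶜ s)}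

end General

variable {H : Type*} [NormedAddCommGroup H] [InnerProductSpace ℝ H] [CompleteSpace H]
  [Module ℍ H] [IsScalarTower ℝ ℍ H] [SMulCommClass ℝ ℍ H] [SMulCommClass ℍ ℝ H]

/-- The restriction of `T` to an invariant ℍ-submodule `M`, as a continuous
ℍ-linear operator on `M`. -/
def restrictOp (T : H →L[ℍ] H) (M : Submodule ℍ H) (h : ∀ x ∈ M, T x ∈ M) : M →L[ℍ] M :=
  { toLinearMap := (T : H →ₗ[ℍ] H).restrict h
    cont := by
      exact Continuous.subtype_mk (T.continuous.comp continuous_subtype_val) _ }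

section QuadraticPencil

variable {R : Type*} [NormedRing R] [NormedAlgebra ℝ R]

/-- The quadratic pencil `a² − 2(Re s)·a + ‖s‖²` in a real normed algebra. -/
def quadraticPencil (a : R) (s : ℍ) : R :=
  a * a - (2 * s.re) • a + (‖s‖ ^ 2) • (1 : R)

theorem continuous_quadraticPencil (a : R) : Continuous (quadraticPencil a) := by
  have hre : Continuous fun s : ℍ => s.re := Quaternion.continuous_re
  unfold quadraticPencil
  fun_prop

theorem isOpen_setOf_isUnit_quadraticPencil [CompleteSpace R] (a : R) :
    IsOpen {s | IsUnit (quadraticPencil a s)} :=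
  Units.isOpen.preimage (continuous_quadraticPencil a)

theorem isUnit_quadraticPencil_of_lt_norm [CompleteSpace R] (a : R) {s : ℍ}
    (hs : 3 * ‖a‖ < ‖s‖) : IsUnit (quadraticPencil a s) := by
  have ha : 0 ≤ ‖a‖ := norm_nonneg a
  have hpos : 0 < ‖s‖ := by linarith
  have hre : |s.re| ≤ ‖s‖ := by
    refine abs_le_of_sq_le_sq ?_ hpos.le
    rw [sq ‖s‖, ← Quaternion.normSq_eq_norm_mul_self, Quaternion.normSq_def']
    nlinarith [sq_nonneg s.imI, sq_nonneg s.imJ, sq_nonneg s.imK]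
  set b : R := (2 * s.re) • a - a * a with hb
  have hbn : ‖b‖ < ‖s‖ ^ 2 := by
    have h1 : ‖(2 * s.re) • a‖ = 2 * |s.re| * ‖a‖ := by
      rw [norm_smul, Real.norm_eq_abs, abs_mul, abs_two]
    have h2 := norm_sub_le ((2 * s.re) • a) (a * a)
    have h3 := norm_mul_le a a
    have h4 := mul_le_mul_of_nonneg_right hre ha
    nlinarith
  have hsmall : ‖(‖s‖ ^ 2)⁻¹ • b‖ < 1 := by
    rw [norm_smul, norm_inv, norm_pow, norm_norm, inv_mul_lt_iff₀ (by positivity), mul_one]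
    exact hbn
  have hne : ‖s‖ ^ 2 ≠ 0 := by positivity
  have heq : quadraticPencil a s = (Units.mk0 _ hne) • (1 - (‖s‖ ^ 2)⁻¹ • b) := by
    rw [Units.smul_mk0, smul_sub, smul_smul, mul_inv_cancel₀ hne, one_smul, hb, quadraticPencil]
    abel
  rw [heq]
  exact (isUnit_one_sub_of_norm_lt_one hsmall).smul _

end QuadraticPencil

theorem isUnit_QOp_iff {W : Type*} [NormedAddCommGroup W] [NormedSpace ℝ W] [Module ℍ W]
    [IsScalarTower ℝ ℍ W] [SMulCommClass ℍ ℝ W] (T : W →L[ℍ] W) (s : ℍ) :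
    IsUnit (QOp T s) ↔ IsUnit (quadraticPencil (T.restrictScalars ℝ) s) := by
  constructor
  · rintro ⟨u, hu⟩
    refine ⟨⟨quadraticPencil (T.restrictScalars ℝ) s,
      (↑u⁻¹ : W →L[ℍ] W).restrictScalars ℝ, ?_, ?_⟩, rfl⟩
    · ext x
      have := DFunLike.congr_fun u.mul_inv x
      rw [hu] at this
      exact this
    · ext x
      have := DFunLike.congr_fun u.inv_mul x
      rw [hu] at this
      exact this
  · rintro ⟨u, hu⟩
    have h1 : ∀ x, QOp T s ((↑u⁻¹ : W →L[ℝ] W) x) = x := fun x => by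
      have := DFunLike.congr_fun u.mul_inv x
      rw [hu] at this
      exact this
    have h2 : ∀ x, (↑u⁻¹ : W →L[ℝ] W) (QOp T s x) = x := fun x => by
      have := DFunLike.congr_fun u.inv_mul x
      rw [hu] at this
      exact this
    let G : W →L[ℍ] W :=
      { toFun := (↑u⁻¹ : W →L[ℝ] W)
        map_add' := map_add _
        map_smul' := fun q x => by
          have h := h2 (q • (↑u⁻¹ : W →L[ℝ] W) x)
          rw [map_smul, h1] at h
          exact h
        cont := (↑u⁻¹ : W →L[ℝ] W).continuous }
    exact ⟨⟨QOp T s, G, ContinuousLinearMap.ext h1, ContinuousLinearMap.ext h2⟩, rfl⟩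

/-- For `s` in the S-resolvent set of `T`, the restriction of `𝒬_s(T)` to `M` is invertible
exactly when `M` is invariant under `𝒬_s(T)⁻¹`. -/
theorem isUnit_QOp_restrictOp_iff {H : Type*} [NormedAddCommGroup H] [InnerProductSpace ℝ H]
    [Module ℍ H] [IsScalarTower ℝ ℍ H] [SMulCommClass ℝ ℍ H] [SMulCommClass ℍ ℝ H]
    (T : H →L[ℍ] H) (M : Submodule ℍ H) (hinv : ∀ x ∈ M, T x ∈ M) {s : ℍ}
    (hs : IsUnit (QOp T s)) :
    IsUnit (QOp (restrictOp T M hinv) s) ↔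
      ∀ x ∈ M, Ring.inverse (quadraticPencil (T.restrictScalars ℝ) s) x ∈ M := by
  have hs' := (isUnit_QOp_iff T s).1 hs
  have hl : ∀ x, Ring.inverse (quadraticPencil (T.restrictScalars ℝ) s) (QOp T s x) = x :=
    fun x => DFunLike.congr_fun (Ring.inverse_mul_cancel _ hs') x
  have hr : ∀ x, QOp T s (Ring.inverse (quadraticPencil (T.restrictScalars ℝ) s) x) = x :=
    fun x => DFunLike.congr_fun (Ring.mul_inverse_cancel _ hs') x
  constructor
  · rintro ⟨u, hu⟩ x hx
    have h := DFunLike.congr_fun u.mul_inv ⟨x, hx⟩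
    rw [hu] at h
    have h' : QOp T s ((↑u⁻¹ : M →L[ℍ] M) ⟨x, hx⟩ : M) = x := congrArg Subtype.val h
    rw [← h', hl]
    exact Subtype.property _
  · intro h
    refine (isUnit_QOp_iff _ s).2 ⟨⟨quadraticPencil ((restrictOp T M hinv).restrictScalars ℝ) s,
      ((Ring.inverse (quadraticPencil (T.restrictScalars ℝ) s)).comp
        (M.restrictScalars ℝ).subtypeL).codRestrict (M.restrictScalars ℝ)
          fun x => h x x.2, ?_, ?_⟩, rfl⟩
    · ext x
      exact hr x
    · ext x
      exact hl x

/-- The S-spectrum of the restriction of `T` to a closed invariant subspace is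
contained in the full S-spectrum of `T`. -/
theorem sSpectrum_restrict_subset_fullSSpectrum (T : H →L[ℍ] H)
    (hnorm : ∀ (q : ℍ) (x : H), ‖q • x‖ = ‖q‖ * ‖x‖)
    (M : Submodule ℍ H) (hMc : IsClosed (M : Set H)) (hinv : ∀ x ∈ M, T x ∈ M) :
    sSpectrum (restrictOp T M hinv) ⊆ fullSSpectrum T := by
  intro s hsM
  by_contra hs
  simp only [fullSSpectrum, Set.mem_union, Set.mem_ofPred_eq, not_or, not_and] at hs
  obtain ⟨hsT, hunb⟩ := hs
  have hC := hunb hsT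
  have hMcomplete : CompleteSpace M := hMc.completeSpace_coe
  set C := connectedComponentIn (sSpectrum T)ᶜ s
  set TM := restrictOp T M hinv
  have hCsub : ∀ p ∈ C, IsUnit (QOp T p) := fun p hp =>
    not_not.1 (connectedComponentIn_subset _ _ hp)
  let U : Set ℍ := {p | IsUnit (QOp T p)} ∩ {p | IsUnit (QOp TM p)}
  have hUopen : IsOpen U := by
    simp only [U, isUnit_QOp_iff]
    exact (isOpen_setOf_isUnit_quadraticPencil _).inter (isOpen_setOf_isUnit_quadraticPencil _)
  have hne : (C ∩ U).Nonempty := by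
    by_contra hempty
    refine hC ((Metric.isBounded_closedBall (x := (0 : ℍ))
      (r := 3 * ‖TM.restrictScalars ℝ‖)).subset fun p hp => ?_)
    rw [mem_closedBall_zero_iff]
    by_contra! hlt
    exact hempty ⟨p, hp, hCsub p hp,
      (isUnit_QOp_iff TM p).2 (isUnit_quadraticPencil_of_lt_norm _ hlt)⟩
  have hclosure : closure U ∩ C ⊆ U := by
    rintro p ⟨hpU, hpC⟩
    have hpT := hCsub p hpC
    refine ⟨hpT, (isUnit_QOp_restrictOp_iff T M hinv hpT).2 fun x hx => ?_⟩
    obtain ⟨u, hu⟩ := (isUnit_QOp_iff T p).1 hpT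
    have hcont : ContinuousAt
        (fun q => Ring.inverse (quadraticPencil (T.restrictScalars ℝ) q) x) p := by
      have hinvc : ContinuousAt Ring.inverse (quadraticPencil (T.restrictScalars ℝ) p) :=
        hu ▸ NormedRing.inverse_continuousAt u
      exact (ContinuousLinearMap.apply ℝ H x).continuous.continuousAt.comp
        (ContinuousAt.comp hinvc (continuous_quadraticPencil _).continuousAt)
    have hmem := hcont.continuousWithinAt.mem_closure hpU (t := (M : Set H))
      fun q hq => (isUnit_QOp_restrictOp_iff T M hinv hq.1).1 hq.2 x hx
    rwa [hMc.closure_eq] at hmem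
  exact hsM (isPreconnected_connectedComponentIn.subset_of_closure_inter_subset hUopen hne
    hclosure (mem_connectedComponentIn hsT)).2
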